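/- Fix a single product with horizon T, and consider two trajectories generated by the same demands D_t, prices p_t ≤ p_max, costs c_t ≤ c_max, lead times v_t, and initial inventory I_0, but by two different order sequences a and ā. Then for every t, the per-period reward deviation satisfies |R_t − R̄_t| ≤ p_max·Σ_{0≤k<t} |a_k − ā_k| + c_max·|a_t − ā_t|, and consequently for any discount factor γ ∈ [0,1] the cumulative discounted reward deviation satisfies |Σ_{t=0}^T γ^t R_t − Σ_{t=0}^T γ^t R̄_t| ≤ (p_max + c_max)·(T+1)·Σ_{t=0}^T |a_t − ā_t|. -/

import Mathlib

/-!
STATEMENT 5: Single-product rewards. Two trajectories share demands, prices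
(`p t ≤ pmax`), costs (`c t ≤ cmax`), lead times and initial inventory, but are
driven by different order sequences `a` and `abar`. Then the per-period reward
deviation satisfies
`|R_t - R̄_t| ≤ pmax·∑_{k<t} |a k - abar k| + cmax·|a t - abar t|`, and for any
discount factor `γ ∈ [0,1]` the cumulative discounted reward deviation satisfies
`|∑_{t=0}^T γ^t R_t - ∑_{t=0}^T γ^t R̄_t| ≤ (pmax+cmax)·(T+1)·∑_{t=0}^T |a t - abar t|`.
-/

open Finset

namespace CapInv

/-- Arrivals at time `t`: the order `a k` placed at time `k < t` arrives iff its
lead time satisfies `v k = t - k`, i.e. `k + v k = t`. -/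
def arrivals (a : ℕ → ℝ) (v : ℕ → ℕ) (t : ℕ) : ℝ :=
  ∑ k ∈ Finset.range t, if k + v k = t then a k else 0

/-- End-of-period inventory `I_t = max(I_{t-1} + J_t - D_t, 0)`. -/
def inv (I0 : ℝ) (D a : ℕ → ℝ) (v : ℕ → ℕ) : ℕ → ℝ
  | 0 => I0
  | t + 1 => max (inv I0 D a v t + arrivals a v (t + 1) - D (t + 1)) 0

/-- Pre-demand inventory `I_{t_-} = I_{t-1} + J_t`. -/
def invPre (I0 : ℝ) (D a : ℕ → ℝ) (v : ℕ → ℕ) (t : ℕ) : ℝ :=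
  inv I0 D a v (t - 1) + arrivals a v t

/-- Per-period reward `R_t = p_t·min(D_t, I_{t_-}) - c_t·a_t`. -/
def reward (I0 : ℝ) (D p c a : ℕ → ℝ) (v : ℕ → ℕ) (t : ℕ) : ℝ :=
  p t * min (D t) (invPre I0 D a v t) - c t * a t

/-- The deviation of arrivals is controlled by the deviations of the orders that arrive. -/
lemma abs_arrivals_sub_le (a abar : ℕ → ℝ) (v : ℕ → ℕ) (t : ℕ) :
    |arrivals a v t - arrivals abar v t| ≤
      ∑ k ∈ range t, if k + v k = t then |a k - abar k| else 0 := by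
  unfold arrivals
  rw [← sum_sub_distrib]
  refine (abs_sum_le_sum_abs _ _).trans (sum_le_sum fun k _ => ?_)
  split_ifs <;> simp

/-- The deviation of arrivals at `t + 1` adds to the deviations of the orders received by `t`
to give at most the deviations of the orders received by `t + 1`. -/
lemma sum_received_add_sum_arriving_le (x : ℕ → ℝ) (hx : ∀ k, 0 ≤ x k) (v : ℕ → ℕ) (t : ℕ) :
    (∑ k ∈ range t, if k + v k ≤ t then x k else 0) +
        (∑ k ∈ range (t + 1), if k + v k = t + 1 then x k else 0) ≤
      ∑ k ∈ range (t + 1), if k + v k ≤ t + 1 then x k else 0 := by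
  have hmono : (∑ k ∈ range t, if k + v k ≤ t then x k else 0) ≤
      ∑ k ∈ range (t + 1), if k + v k ≤ t then x k else 0 :=
    sum_le_sum_of_subset_of_nonneg (range_mono t.le_succ) fun k _ _ => by
      split_ifs <;> simp [hx k]
  refine (add_le_add_left hmono _).trans ?_
  rw [← sum_add_distrib]
  refine sum_le_sum fun k _ => ?_
  have := hx k
  split_ifs <;> first | omega | linarith

/-- Inventories deviate by at most the total deviation of the orders received so far. -/
lemma abs_inv_sub_le (I0 : ℝ) (D a abar : ℕ → ℝ) (v : ℕ → ℕ) (t : ℕ) :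
    |inv I0 D a v t - inv I0 D abar v t| ≤
      ∑ k ∈ range t, if k + v k ≤ t then |a k - abar k| else 0 := by
  induction t with
  | zero => simp [inv]
  | succ t ih =>
    refine le_trans ?_ (sum_received_add_sum_arriving_le (fun k => |a k - abar k|)
      (fun k => abs_nonneg _) v t)
    have harr := abs_arrivals_sub_le a abar v (t + 1)
    refine (abs_max_sub_max_le_abs _ _ _).trans ?_
    rw [sub_sub_sub_cancel_right, add_sub_add_comm]
    exact (abs_add_le _ _).trans (add_le_add ih harr)

/-- Pre-demand inventories deviate by at most the total deviation of the past orders. -/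
lemma abs_invPre_sub_le (I0 : ℝ) (D a abar : ℕ → ℝ) (v : ℕ → ℕ) (t : ℕ) :
    |invPre I0 D a v t - invPre I0 D abar v t| ≤ ∑ k ∈ range t, |a k - abar k| := by
  cases t with
  | zero => simp [invPre, inv, arrivals]
  | succ t =>
    unfold invPre
    rw [add_sub_add_comm]
    calc _ ≤ _ := abs_add_le _ _
      _ ≤ _ := add_le_add (abs_inv_sub_le I0 D a abar v t) (abs_arrivals_sub_le a abar v (t + 1))
      _ ≤ _ := sum_received_add_sum_arriving_le (fun k => |a k - abar k|)
        (fun k => abs_nonneg _) v t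
      _ ≤ _ := sum_le_sum fun k _ => by split_ifs <;> simp

/-- Rewards deviate by at most the weighted deviations of the past and current orders. -/
lemma abs_reward_sub_le (D p c a abar : ℕ → ℝ) (v : ℕ → ℕ) (I0 pmax cmax : ℝ) (t : ℕ)
    (hp : 0 ≤ p t) (hpmax : p t ≤ pmax) (hc : 0 ≤ c t) (hcmax : c t ≤ cmax) :
    |reward I0 D p c a v t - reward I0 D p c abar v t| ≤
      pmax * ∑ k ∈ range t, |a k - abar k| + cmax * |a t - abar t| := by
  have hmin : |min (D t) (invPre I0 D a v t) - min (D t) (invPre I0 D abar v t)| ≤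
      ∑ k ∈ range t, |a k - abar k| := by
    refine (abs_min_sub_min_le_max _ _ _ _).trans ?_
    rw [sub_self, abs_zero, max_eq_right (abs_nonneg _)]
    exact abs_invPre_sub_le I0 D a abar v t
  unfold reward
  rw [sub_sub_sub_comm, ← mul_sub, ← mul_sub]
  refine (abs_sub _ _).trans ?_
  rw [abs_mul, abs_mul, abs_of_nonneg hp, abs_of_nonneg hc]
  exact add_le_add (mul_le_mul hpmax hmin (abs_nonneg _) (hp.trans hpmax))
    (mul_le_mul_of_nonneg_right hcmax (abs_nonneg _))

theorem reward_deviation_le_order_deviation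
    (T : ℕ) (D p c a abar : ℕ → ℝ) (v : ℕ → ℕ) (I0 pmax cmax γ : ℝ)
    (hD : ∀ t, 0 ≤ D t)
    (hp : ∀ t, 0 ≤ p t) (hpmax : ∀ t, p t ≤ pmax)
    (hc : ∀ t, 0 ≤ c t) (hcmax : ∀ t, c t ≤ cmax)
    (ha : ∀ t, 0 ≤ a t) (habar : ∀ t, 0 ≤ abar t)
    (hI0 : 0 ≤ I0) (hγ0 : 0 ≤ γ) (hγ1 : γ ≤ 1) :
    (∀ t, t ≤ T →
      |reward I0 D p c a v t - reward I0 D p c abar v t| ≤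
        pmax * ∑ k ∈ range t, |a k - abar k| + cmax * |a t - abar t|) ∧
    |(∑ t ∈ range (T + 1), γ ^ t * reward I0 D p c a v t) -
        ∑ t ∈ range (T + 1), γ ^ t * reward I0 D p c abar v t| ≤
      (pmax + cmax) * (T + 1) * ∑ t ∈ range (T + 1), |a t - abar t| := by
  have hreward : ∀ t, |reward I0 D p c a v t - reward I0 D p c abar v t| ≤
      pmax * ∑ k ∈ range t, |a k - abar k| + cmax * |a t - abar t| := fun t =>
    abs_reward_sub_le D p c a abar v I0 pmax cmax t (hp t) (hpmax t) (hc t) (hcmax t)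
  refine ⟨fun t _ => hreward t, ?_⟩
  set S := ∑ t ∈ range (T + 1), |a t - abar t|
  have hterm : ∀ t ∈ range (T + 1),
      |γ ^ t * reward I0 D p c a v t - γ ^ t * reward I0 D p c abar v t| ≤
        (pmax + cmax) * S := by
    intro t ht
    have hpast : ∑ k ∈ range t, |a k - abar k| ≤ S :=
      sum_le_sum_of_subset_of_nonneg (range_mono (mem_range.mp ht).le)
        fun k _ _ => abs_nonneg _
    have hcurrent : |a t - abar t| ≤ S :=
      single_le_sum (f := fun k => |a k - abar k|) (fun k _ => abs_nonneg _) ht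
    rw [← mul_sub, abs_mul, abs_of_nonneg (pow_nonneg hγ0 t), add_mul]
    calc _ ≤ |reward I0 D p c a v t - reward I0 D p c abar v t| :=
          mul_le_of_le_one_left (abs_nonneg _) (pow_le_one₀ hγ0 hγ1)
      _ ≤ _ := hreward t
      _ ≤ pmax * S + cmax * S :=
          add_le_add (mul_le_mul_of_nonneg_left hpast ((hp t).trans (hpmax t)))
            (mul_le_mul_of_nonneg_left hcurrent ((hc t).trans (hcmax t)))
  rw [← sum_sub_distrib]
  refine (abs_sum_le_sum_abs _ _).trans ((sum_le_card_nsmul _ _ _ hterm).trans_eq ?_)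
  rw [card_range, nsmul_eq_mul]
  push_cast
  ring

end CapInv
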